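/- arXiv:2409.07398 — 8 statements merged into one kernel-verified Lean document; each statement's English description precedes it below -/
import Mathlib

section
/- Let ε ∈ (0, 1/13] and δ = ε²/Z. If (x, x', y) ∈ [0,1]^{3n} is a δ-approximate KKT point of min_{(x,x') ∈ [0,1]^{2n}} max_{y ∈ [0,1]^n} M(x, x', y), then x is an ε-approximate KKT point of min_{x ∈ [0,1]^n} Q(x). -/
open Finset

/-- If the `y`-coordinate is an approximate maximizer, the coupling constraint
`x' ≈ (1 - 2η) x + η` holds and `x'`, `y` are interior, so the gradient in `x'` is small. -/
lemma coupling_of_kkt {Z a δ η x x' y : ℝ} (hZ : 1 ≤ Z) (ha : |a| ≤ Z)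
    (hδ : 0 < δ) (hη : η = 2 * δ)
    (hx : x ∈ Set.Icc (0 : ℝ) 1) (hx' : x' ∈ Set.Icc (0 : ℝ) 1) (hy : y ∈ Set.Icc (0 : ℝ) 1)
    (hη1 : 2 * η ≤ 1)
    (hkktx' : (x' ∈ Set.Ioo (0 : ℝ) 1 → |a * x + 10 * Z * (y - 1 / 2)| ≤ δ) ∧
      (x' = 0 → -δ ≤ a * x + 10 * Z * (y - 1 / 2)) ∧
      (x' = 1 → a * x + 10 * Z * (y - 1 / 2) ≤ δ))
    (hkkty : (y ∈ Set.Ioo (0 : ℝ) 1 → |10 * Z * (x' - (1 - 2 * η) * x - η)| ≤ δ) ∧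
      (y = 0 → 10 * Z * (x' - (1 - 2 * η) * x - η) ≤ δ) ∧
      (y = 1 → -δ ≤ 10 * Z * (x' - (1 - 2 * η) * x - η))) :
    |10 * Z * (x' - (1 - 2 * η) * x - η)| ≤ δ ∧ |a * x + 10 * Z * (y - 1 / 2)| ≤ δ := by
  obtain ⟨hx0, hx1⟩ := hx
  have hax : |a * x| ≤ Z := by
    rw [abs_mul, abs_of_nonneg hx0]
    exact (mul_le_of_le_one_right (abs_nonneg a) hx1).trans ha
  obtain ⟨hax1, hax2⟩ := abs_le.mp hax
  have hlo : 0 ≤ (1 - 2 * η) * x := mul_nonneg (by linarith) hx0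
  have hhi : (1 - 2 * η) * x ≤ 1 - 2 * η := mul_le_of_le_one_right (by linarith) hx1
  have pos : -δ ≤ 10 * Z * (x' - (1 - 2 * η) * x - η) → 0 < x' := by
    intro h
    by_contra! hc
    nlinarith
  have lt_one : 10 * Z * (x' - (1 - 2 * η) * x - η) ≤ δ → x' < 1 := by
    intro h
    by_contra! hc
    nlinarith
  have hy1 : y ≠ 1 := by
    intro h
    have hp := pos (hkkty.2.2 h)
    have : a * x + 10 * Z * (y - 1 / 2) ≤ δ := by
      rcases hx'.2.lt_or_eq with h1 | h1
      · exact (abs_le.mp (hkktx'.1 ⟨hp, h1⟩)).2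
      · exact hkktx'.2.2 h1
    rw [h] at this
    linarith
  have hy0 : y ≠ 0 := by
    intro h
    have hp := lt_one (hkkty.2.1 h)
    have : -δ ≤ a * x + 10 * Z * (y - 1 / 2) := by
      rcases hx'.1.lt_or_eq with h1 | h1
      · exact (abs_le.mp (hkktx'.1 ⟨h1, hp⟩)).1
      · exact hkktx'.2.1 h1.symm
    rw [h] at this
    linarith
  have hd := hkkty.1 ⟨lt_of_le_of_ne hy.1 hy0.symm, lt_of_le_of_ne hy.2 hy1⟩
  exact ⟨hd, hkktx'.1 ⟨pos (abs_le.mp hd).1, lt_one (abs_le.mp hd).2⟩⟩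

/-- The gradients of `Q` and `M` in `x` differ by at most `7.1 Zδ` once the coupling
constraint and the gradient in `x'` are `δ`-small. -/
lemma abs_grad_sub_le {Z a δ η x x' y S : ℝ} (hZ : 1 ≤ Z) (ha : |a| ≤ Z)
    (hδ : 0 < δ) (hη : η = 2 * δ) (hη1 : 2 * η ≤ 1) (hx : x ∈ Set.Icc (0 : ℝ) 1)
    (hd : |10 * Z * (x' - (1 - 2 * η) * x - η)| ≤ δ)
    (he : |a * x + 10 * Z * (y - 1 / 2)| ≤ δ) :
    |(S + 2 * a * x) - (S + a * x' + 10 * Z * (1 - 2 * η) * (1 / 2 - y))|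
      ≤ 71 / 10 * (Z * δ) := by
  have hZ0 : 0 < Z := by linarith
  set d := x' - (1 - 2 * η) * x - η with hd_def
  set e := a * x + 10 * Z * (y - 1 / 2) with he_def
  have key : (S + 2 * a * x) - (S + a * x' + 10 * Z * (1 - 2 * η) * (1 / 2 - y))
      = a * (η * (4 * x - 1)) - a * d + (1 - 2 * η) * e := by
    rw [hd_def, he_def]; ring
  have hcoord : |η * (4 * x - 1)| ≤ 6 * δ := by
    rw [abs_mul, abs_of_nonneg (by linarith : 0 ≤ η)]
    have : |4 * x - 1| ≤ 3 := abs_le.mpr ⟨by linarith [hx.1], by linarith [hx.2]⟩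
    nlinarith
  have h1 : |a * (η * (4 * x - 1))| ≤ Z * (6 * δ) := by
    rw [abs_mul]
    exact mul_le_mul ha hcoord (abs_nonneg _) hZ0.le
  have h2 : |a * d| ≤ δ / 10 := by
    rw [abs_mul, abs_of_pos (by linarith : 0 < 10 * Z)] at hd
    rw [abs_mul]
    have := mul_le_mul_of_nonneg_right ha (abs_nonneg d)
    linarith
  have h3 : |(1 - 2 * η) * e| ≤ δ := by
    rw [abs_mul, abs_of_nonneg (by linarith : 0 ≤ 1 - 2 * η)]
    exact (mul_le_of_le_one_left (abs_nonneg e) (by linarith)).trans he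
  have hδZ : δ ≤ Z * δ := le_mul_of_one_le_left hδ.le hZ
  rw [key, abs_le]
  rw [abs_le] at h1 h2 h3
  constructor <;> linarith

/-- Claim 1 of the paper: if `(x, x', y)` is a `δ = ε²/Z`-approximate KKT point
of `min_{(x,x') ∈ [0,1]^{2n}} max_{y ∈ [0,1]^n} M(x, x', y)`, where
`M(x, x', y) = Q'(x, x') + T ∑ᵢ (x'ᵢ - (1-2η)xᵢ - η)(yᵢ - 1/2)`, `T = 10Z`, `η = 2ε²/Z`,
then `x` is an `ε`-approximate KKT point of `min_{x ∈ [0,1]^n} Q(x)`. -/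
theorem stage_one_correctness
    (n : ℕ) (c : ℝ) (ql : Fin n → ℝ) (qc : Fin n → Fin n → ℝ)
    (Z ε δ T η : ℝ) (hZ : 1 ≤ Z)
    (hcoef : |c| + (∑ i, |ql i|) + (∑ i, ∑ j ∈ univ \ {i}, |qc i j|) + (∑ i, |qc i i|) ≤ Z)
    (hε : ε ∈ Set.Ioc (0 : ℝ) (1 / 13)) (hδ : δ = ε ^ 2 / Z)
    (hT : T = 10 * Z) (hη : η = 2 * ε ^ 2 / Z)
    -- the candidate point, lying in the box
    (x x' y : Fin n → ℝ)
    (hx : ∀ i, x i ∈ Set.Icc (0 : ℝ) 1) (hx' : ∀ i, x' i ∈ Set.Icc (0 : ℝ) 1)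
    (hy : ∀ i, y i ∈ Set.Icc (0 : ℝ) 1)
    -- gradients of M(x, x', y) = Q'(x, x') + T ∑ᵢ (x'ᵢ - (1-2η)xᵢ - η)(yᵢ - 1/2)
    -- at the point (x, x', y), with respect to xᵢ, x'ᵢ and yᵢ respectively
    (gx gx' gy : Fin n → ℝ)
    (hgx : ∀ i, gx i = (ql i + (∑ j ∈ univ \ {i}, (qc i j + qc j i) * x j) + qc i i * x' i)
      + T * (1 - 2 * η) * (1 / 2 - y i))
    (hgx' : ∀ i, gx' i = qc i i * x i + T * (y i - 1 / 2))
    (hgy : ∀ i, gy i = T * (x' i - (1 - 2 * η) * x i - η))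
    -- δ-approximate KKT conditions: (x, x') are min-variables, y are max-variables
    (hkktx : ∀ i, (x i ∈ Set.Ioo (0 : ℝ) 1 → |gx i| ≤ δ) ∧ (x i = 0 → -δ ≤ gx i)
      ∧ (x i = 1 → gx i ≤ δ))
    (hkktx' : ∀ i, (x' i ∈ Set.Ioo (0 : ℝ) 1 → |gx' i| ≤ δ) ∧ (x' i = 0 → -δ ≤ gx' i)
      ∧ (x' i = 1 → gx' i ≤ δ))
    (hkkty : ∀ i, (y i ∈ Set.Ioo (0 : ℝ) 1 → |gy i| ≤ δ) ∧ (y i = 0 → gy i ≤ δ)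
      ∧ (y i = 1 → -δ ≤ gy i))
    -- gradient of Q at x
    (gQ : Fin n → ℝ)
    (hgQ : ∀ i, gQ i = ql i + (∑ j ∈ univ \ {i}, (qc i j + qc j i) * x j) + 2 * qc i i * x i) :
    -- conclusion: x is an ε-approximate KKT point of min_{x ∈ [0,1]^n} Q(x)
    ∀ i, (x i ∈ Set.Ioo (0 : ℝ) 1 → |gQ i| ≤ ε) ∧ (x i = 0 → -ε ≤ gQ i)
      ∧ (x i = 1 → gQ i ≤ ε) := by
  intro i
  obtain ⟨hε0, hε1⟩ := hε
  have hZ0 : 0 < Z := by linarith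
  have hδ0 : 0 < δ := by rw [hδ]; positivity
  have hZδ : Z * δ = ε ^ 2 := by rw [hδ]; field_simp
  have hηδ : η = 2 * δ := by rw [hη, hδ]; ring
  have hδZ : δ ≤ Z * δ := le_mul_of_one_le_left hδ0.le hZ
  have hεsq : 13 * ε ^ 2 ≤ ε := by nlinarith
  have ha : |qc i i| ≤ Z := by
    have h1 : |qc i i| ≤ ∑ i, |qc i i| :=
      single_le_sum (f := fun i => |qc i i|) (fun j _ => abs_nonneg _) (mem_univ i)
    have h2 : 0 ≤ ∑ i, |ql i| := sum_nonneg fun j _ => abs_nonneg _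
    have h3 : 0 ≤ ∑ i, ∑ j ∈ univ \ {i}, |qc i j| :=
      sum_nonneg fun j _ => sum_nonneg fun k _ => abs_nonneg _
    linarith [abs_nonneg c]
  have hη1 : 2 * η ≤ 1 := by linarith
  have hkx' := hkktx' i
  have hky := hkkty i
  rw [hgx', hT] at hkx'
  rw [hgy, hT] at hky
  obtain ⟨hd, he⟩ := coupling_of_kkt hZ ha hδ0 hηδ (hx i) (hx' i) (hy i) hη1
    hkx' hky
  have hdiff : |gQ i - gx i| ≤ ε - δ := by
    rw [hgQ, hgx, hT]
    exact (abs_grad_sub_le hZ ha hδ0 hηδ hη1 (hx i) hd he).trans (by linarith)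
  obtain ⟨hlo, hhi⟩ := abs_le.mp hdiff
  obtain ⟨hint, hzero, hone⟩ := hkktx i
  refine ⟨fun h => ?_, fun h => ?_, fun h => ?_⟩
  · have := abs_le.mp (hint h)
    exact abs_le.mpr ⟨by linarith, by linarith⟩
  · linarith [hzero h]
  · linarith [hone h]
end

section
/- Let ε ∈ (0, 1/13] and δ = ε²/Z. If (x, x', y) ∈ [0,1]^{3n} is a δ-approximate KKT point of min_{(x,x') ∈ [0,1]^{2n}} max_{y ∈ [0,1]^n} M(x, x', y), then y_i ∈ (0,1) for every i ∈ [n], and consequently |∂M(x, x', y)/∂y_i| ≤ δ for every i ∈ [n]. -/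
open Finset

/-- The off-diagonal row and column of index `i`, together with the linear and diagonal
coefficients, contribute at most twice the total coefficient mass to the `i`-th derivative. -/
lemma abs_quadratic_partial_le {ι : Type*} [Fintype ι] [DecidableEq ι]
    (ql : ι → ℝ) (qc : ι → ι → ℝ) {Z : ℝ}
    (hcoef : (∑ i, |ql i|) + (∑ i, ∑ j ∈ univ \ {i}, |qc i j|) + (∑ i, |qc i i|) ≤ Z)
    {x : ι → ℝ} (hx : ∀ i, |x i| ≤ 1) {t : ℝ} (ht : |t| ≤ 1) (i : ι) :
    |ql i + (∑ j ∈ univ \ {i}, (qc i j + qc j i) * x j) + qc i i * t| ≤ 2 * Z := by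
  have hlin : |ql i| ≤ ∑ k, |ql k| :=
    single_le_sum (f := fun k => |ql k|) (fun _ _ => abs_nonneg _) (mem_univ i)
  have hdiag : |qc i i| ≤ ∑ k, |qc k k| :=
    single_le_sum (f := fun k => |qc k k|) (fun _ _ => abs_nonneg _) (mem_univ i)
  have hrow : ∑ j ∈ univ \ {i}, |qc i j| ≤ ∑ k, ∑ j ∈ univ \ {k}, |qc k j| :=
    single_le_sum (f := fun k => ∑ j ∈ univ \ {k}, |qc k j|)
      (fun _ _ => sum_nonneg fun _ _ => abs_nonneg _) (mem_univ i)
  have hcol : ∑ j ∈ univ \ {i}, |qc j i| ≤ ∑ k, ∑ j ∈ univ \ {k}, |qc k j| :=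
    calc ∑ j ∈ univ \ {i}, |qc j i|
        ≤ ∑ k ∈ univ \ {i}, ∑ j ∈ univ \ {k}, |qc k j| := by
          refine sum_le_sum fun k hk => ?_
          refine single_le_sum (f := fun j => |qc k j|) (fun _ _ => abs_nonneg _) ?_
          simpa [eq_comm] using hk
      _ ≤ ∑ k, ∑ j ∈ univ \ {k}, |qc k j| :=
          sum_le_sum_of_subset_of_nonneg (subset_univ _)
            fun _ _ _ => sum_nonneg fun _ _ => abs_nonneg _
  have hcross : |∑ j ∈ univ \ {i}, (qc i j + qc j i) * x j|
      ≤ ∑ j ∈ univ \ {i}, |qc i j| + ∑ j ∈ univ \ {i}, |qc j i| := by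
    rw [← sum_add_distrib]
    refine (abs_sum_le_sum_abs _ _).trans (sum_le_sum fun j _ => ?_)
    rw [abs_mul]
    exact (mul_le_of_le_one_right (abs_nonneg _) (hx j)).trans (abs_add_le _ _)
  have hdiag_mul : |qc i i * t| ≤ |qc i i| := by
    rw [abs_mul]
    exact mul_le_of_le_one_right (abs_nonneg _) ht
  have htriangle := abs_add_three (ql i) (∑ j ∈ univ \ {i}, (qc i j + qc j i) * x j) (qc i i * t)
  linarith [abs_nonneg (ql i), abs_nonneg (qc i i)]

/-- An approximately stationary coordinate of `[0,1]` for minimization whose partial derivative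
exceeds the tolerance sits at the lower endpoint. -/
lemma eq_zero_of_lt_partial {u g δ : ℝ} (hu : u ∈ Set.Icc (0 : ℝ) 1)
    (hint : u ∈ Set.Ioo (0 : ℝ) 1 → |g| ≤ δ) (hone : u = 1 → g ≤ δ) (hg : δ < g) : u = 0 := by
  by_contra hne
  rcases hu.2.lt_or_eq with hlt | heq
  · exact hg.not_ge ((le_abs_self g).trans (hint ⟨hu.1.lt_of_ne' hne, hlt⟩))
  · exact hg.not_ge (hone heq)

/-- An approximately stationary coordinate of `[0,1]` for minimization whose partial derivative
is below minus the tolerance sits at the upper endpoint. -/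
lemma eq_one_of_partial_lt {u g δ : ℝ} (hu : u ∈ Set.Icc (0 : ℝ) 1)
    (hint : u ∈ Set.Ioo (0 : ℝ) 1 → |g| ≤ δ) (hzero : u = 0 → -δ ≤ g) (hg : g < -δ) :
    u = 1 := by
  by_contra hne
  rcases hu.1.lt_or_eq with hlt | heq
  · exact hg.not_ge (neg_le_of_abs_le (hint ⟨hlt, hu.2.lt_of_ne hne⟩))
  · exact hg.not_ge (hzero heq.symm)

/-- at any `δ = ε²/Z`-approximate KKT point `(x, x', y)` of
`min_{(x,x')} max_y M(x, x', y)`, every `yᵢ` lies in the open interval `(0,1)` and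
consequently `|∂M(x,x',y)/∂yᵢ| ≤ δ`. -/
theorem y_variables_interior
    (n : ℕ) (c : ℝ) (ql : Fin n → ℝ) (qc : Fin n → Fin n → ℝ)
    (Z ε δ T η : ℝ) (hZ : 1 ≤ Z)
    (hcoef : |c| + (∑ i, |ql i|) + (∑ i, ∑ j ∈ univ \ {i}, |qc i j|) + (∑ i, |qc i i|) ≤ Z)
    (hε : ε ∈ Set.Ioc (0 : ℝ) (1 / 13)) (hδ : δ = ε ^ 2 / Z)
    (hT : T = 10 * Z) (hη : η = 2 * ε ^ 2 / Z)
    -- the candidate point, lying in the box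
    (x x' y : Fin n → ℝ)
    (hx : ∀ i, x i ∈ Set.Icc (0 : ℝ) 1) (hx' : ∀ i, x' i ∈ Set.Icc (0 : ℝ) 1)
    (hy : ∀ i, y i ∈ Set.Icc (0 : ℝ) 1)
    -- gradients of M(x, x', y) = Q'(x, x') + T ∑ᵢ (x'ᵢ - (1-2η)xᵢ - η)(yᵢ - 1/2)
    -- at the point (x, x', y), with respect to xᵢ, x'ᵢ and yᵢ respectively
    (gx gx' gy : Fin n → ℝ)
    (hgx : ∀ i, gx i = (ql i + (∑ j ∈ univ \ {i}, (qc i j + qc j i) * x j) + qc i i * x' i)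
      + T * (1 - 2 * η) * (1 / 2 - y i))
    (hgx' : ∀ i, gx' i = qc i i * x i + T * (y i - 1 / 2))
    (hgy : ∀ i, gy i = T * (x' i - (1 - 2 * η) * x i - η))
    -- δ-approximate KKT conditions: (x, x') are min-variables, y are max-variables
    (hkktx : ∀ i, (x i ∈ Set.Ioo (0 : ℝ) 1 → |gx i| ≤ δ) ∧ (x i = 0 → -δ ≤ gx i)
      ∧ (x i = 1 → gx i ≤ δ))
    (hkktx' : ∀ i, (x' i ∈ Set.Ioo (0 : ℝ) 1 → |gx' i| ≤ δ) ∧ (x' i = 0 → -δ ≤ gx' i)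
      ∧ (x' i = 1 → gx' i ≤ δ))
    (hkkty : ∀ i, (y i ∈ Set.Ioo (0 : ℝ) 1 → |gy i| ≤ δ) ∧ (y i = 0 → gy i ≤ δ)
      ∧ (y i = 1 → -δ ≤ gy i))
    :
    -- conclusion: every yᵢ is interior, and hence |∂M/∂yᵢ| ≤ δ
    ∀ i, y i ∈ Set.Ioo (0 : ℝ) 1 ∧ |gy i| ≤ δ := by
  intro i
  obtain ⟨hε0, hε1⟩ := hε
  have hZ0 : 0 < Z := by linarith
  have hδ0 : 0 < δ := by rw [hδ]; positivity
  have hδ1 : δ ≤ 1 / 169 := by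
    rw [hδ]
    exact (div_le_self (sq_nonneg ε) hZ).trans (by nlinarith)
  have hη2 : η = 2 * δ := by rw [hη, hδ]; ring
  have hηZ : η * Z ≤ 2 / 169 * Z := by
    gcongr
    linarith
  have habs : ∀ {t : ℝ}, t ∈ Set.Icc (0 : ℝ) 1 → |t| ≤ 1 := fun ht =>
    abs_le.2 ⟨by linarith [ht.1], ht.2⟩
  obtain ⟨hA₁, hA₂⟩ := abs_le.1 <| abs_quadratic_partial_le ql qc (Z := Z)
    (by linarith [abs_nonneg c]) (fun j => habs (hx j)) (habs (hx' i)) i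
  have hdiag : |qc i i * x i| ≤ Z := by
    have hle : |qc i i| ≤ ∑ k, |qc k k| :=
      single_le_sum (f := fun k => |qc k k|) (fun _ _ => abs_nonneg _) (mem_univ i)
    have hlin : 0 ≤ ∑ k, |ql k| := sum_nonneg fun _ _ => abs_nonneg _
    have hoff : 0 ≤ ∑ k, ∑ j ∈ univ \ {k}, |qc k j| :=
      sum_nonneg fun _ _ => sum_nonneg fun _ _ => abs_nonneg _
    rw [abs_mul]
    linarith [mul_le_of_le_one_right (abs_nonneg (qc i i)) (habs (hx i)), abs_nonneg c]
  obtain ⟨hD₁, hD₂⟩ := abs_le.1 hdiag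
  have hgxi := hgx i
  have hgxi' := hgx' i
  have hgyi := hgy i
  obtain ⟨hx_int, hx_zero, hx_one⟩ := hkktx i
  obtain ⟨hx'_int, hx'_zero, hx'_one⟩ := hkktx' i
  obtain ⟨hy_int, hy_zero, hy_one⟩ := hkkty i
  have hy_ne_zero : y i ≠ 0 := by
    intro h0
    rw [h0, hT] at hgxi hgxi'
    have h1 : x' i = 1 := eq_one_of_partial_lt (hx' i) hx'_int hx'_zero (by linarith)
    have h2 : x i = 0 := eq_zero_of_lt_partial (hx i) hx_int hx_one (by linarith)
    rw [h1, h2, hT] at hgyi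
    linarith [hy_zero h0]
  have hy_ne_one : y i ≠ 1 := by
    intro h0
    rw [h0, hT] at hgxi hgxi'
    have h1 : x' i = 0 := eq_zero_of_lt_partial (hx' i) hx'_int hx'_one (by linarith)
    have h2 : x i = 1 := eq_one_of_partial_lt (hx i) hx_int hx_zero (by linarith)
    rw [h1, h2, hT] at hgyi
    linarith [hy_one h0]
  have hy_mem : y i ∈ Set.Ioo (0 : ℝ) 1 :=
    ⟨(hy i).1.lt_of_ne' hy_ne_zero, (hy i).2.lt_of_ne hy_ne_one⟩
  exact ⟨hy_mem, hy_int hy_mem⟩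
end

section
/- Let ε ∈ (0, 1/13] and δ = ε²/Z. If (x, x', y) ∈ [0,1]^{3n} is a δ-approximate KKT point of min_{(x,x') ∈ [0,1]^{2n}} max_{y ∈ [0,1]^n} M(x, x', y), then for every i ∈ [n]: |x'_i − (1 − 2η)x_i − η| ≤ δ, hence x'_i ∈ (0,1) and |x_i − x'_i| ≤ δ + η. -/
open Finset

/-- at any `δ = ε²/Z`-approximate KKT point `(x, x', y)` of
`min_{(x,x')} max_y M(x, x', y)`, for every `i`: `|x'ᵢ - (1-2η)xᵢ - η| ≤ δ`, hence
`x'ᵢ ∈ (0,1)` and `|xᵢ - x'ᵢ| ≤ δ + η`. -/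
theorem copy_gadget_forces_duplication
    (n : ℕ) (c : ℝ) (ql : Fin n → ℝ) (qc : Fin n → Fin n → ℝ)
    (Z ε δ T η : ℝ) (hZ : 1 ≤ Z)
    (hcoef : |c| + (∑ i, |ql i|) + (∑ i, ∑ j ∈ univ \ {i}, |qc i j|) + (∑ i, |qc i i|) ≤ Z)
    (hε : ε ∈ Set.Ioc (0 : ℝ) (1 / 13)) (hδ : δ = ε ^ 2 / Z)
    (hT : T = 10 * Z) (hη : η = 2 * ε ^ 2 / Z)
    -- the candidate point, lying in the box
    (x x' y : Fin n → ℝ)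
    (hx : ∀ i, x i ∈ Set.Icc (0 : ℝ) 1) (hx' : ∀ i, x' i ∈ Set.Icc (0 : ℝ) 1)
    (hy : ∀ i, y i ∈ Set.Icc (0 : ℝ) 1)
    -- gradients of M(x, x', y) = Q'(x, x') + T ∑ᵢ (x'ᵢ - (1-2η)xᵢ - η)(yᵢ - 1/2)
    -- at the point (x, x', y), with respect to xᵢ, x'ᵢ and yᵢ respectively
    (gx gx' gy : Fin n → ℝ)
    (hgx : ∀ i, gx i = (ql i + (∑ j ∈ univ \ {i}, (qc i j + qc j i) * x j) + qc i i * x' i)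
      + T * (1 - 2 * η) * (1 / 2 - y i))
    (hgx' : ∀ i, gx' i = qc i i * x i + T * (y i - 1 / 2))
    (hgy : ∀ i, gy i = T * (x' i - (1 - 2 * η) * x i - η))
    -- δ-approximate KKT conditions: (x, x') are min-variables, y are max-variables
    (hkktx : ∀ i, (x i ∈ Set.Ioo (0 : ℝ) 1 → |gx i| ≤ δ) ∧ (x i = 0 → -δ ≤ gx i)
      ∧ (x i = 1 → gx i ≤ δ))
    (hkktx' : ∀ i, (x' i ∈ Set.Ioo (0 : ℝ) 1 → |gx' i| ≤ δ) ∧ (x' i = 0 → -δ ≤ gx' i)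
      ∧ (x' i = 1 → gx' i ≤ δ))
    (hkkty : ∀ i, (y i ∈ Set.Ioo (0 : ℝ) 1 → |gy i| ≤ δ) ∧ (y i = 0 → gy i ≤ δ)
      ∧ (y i = 1 → -δ ≤ gy i))
    :
    -- conclusion: the copy gadget forces x'ᵢ ≈ (1-2η)xᵢ + η, x'ᵢ interior, and xᵢ ≈ x'ᵢ
    ∀ i, |x' i - (1 - 2 * η) * x i - η| ≤ δ ∧ x' i ∈ Set.Ioo (0 : ℝ) 1
      ∧ |x i - x' i| ≤ δ + η := by
  intro i
  obtain ⟨hε0, hε1⟩ := hε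
  have hZ0 : 0 < Z := by linarith
  have hδ0 : 0 < δ := by rw [hδ]; positivity
  have hδ1 : δ ≤ 1 / 169 := by
    rw [hδ, div_le_iff₀ hZ0]
    nlinarith
  have hηδ : η = 2 * δ := by rw [hη, hδ]; ring
  have hq : |qc i i| ≤ Z := by
    have hdiag : |qc i i| ≤ ∑ j, |qc j j| :=
      single_le_sum (f := fun j => |qc j j|) (fun j _ => abs_nonneg _) (mem_univ i)
    have hlin : 0 ≤ ∑ j, |ql j| := sum_nonneg fun j _ => abs_nonneg _
    have hoff : 0 ≤ ∑ k, ∑ j ∈ univ \ {k}, |qc k j| :=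
      sum_nonneg fun k _ => sum_nonneg fun j _ => abs_nonneg _
    linarith [abs_nonneg c]
  obtain ⟨hx0, hx1⟩ := hx i
  obtain ⟨hx'0, hx'1⟩ := hx' i
  obtain ⟨hy0, hy1⟩ := hy i
  have hqx : |qc i i * x i| ≤ Z := by
    rw [abs_mul, abs_of_nonneg hx0]
    nlinarith [abs_nonneg (qc i i)]
  obtain ⟨hqx_lower, hqx_upper⟩ := abs_le.mp hqx
  obtain ⟨hx'_int, hx'_zero, hx'_one⟩ := hkktx' i
  obtain ⟨hy_int, hy_zero, hy_one⟩ := hkkty i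
  rw [hgx', hT] at hx'_int hx'_zero hx'_one
  rw [hgy, hT] at hy_int hy_zero hy_one
  have hcopy : |x' i - (1 - 2 * η) * x i - η| ≤ δ := by
    have hηx : 0 ≤ (1 - 2 * η) * x i := mul_nonneg (by linarith) hx0
    have hηx' : 0 ≤ (1 - 2 * η) * (1 - x i) := mul_nonneg (by linarith) (by linarith)
    rcases hy0.eq_or_lt with h0 | h0
    · -- `y i = 0` makes the `x' i`-gradient very negative, forcing `x' i = 1`
      have hx'_eq : x' i = 1 := by
        by_contra hne
        have hlt : x' i < 1 := lt_of_le_of_ne hx'1 hne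
        rw [← h0] at hx'_int hx'_zero
        rcases hx'0.eq_or_lt with h | h
        · linarith [hx'_zero h.symm]
        · linarith [(abs_le.mp (hx'_int ⟨h, hlt⟩)).1]
      have := hy_zero h0.symm
      rw [abs_le]
      constructor <;> nlinarith
    · rcases hy1.eq_or_lt with h1 | h1
      · -- `y i = 1` makes the `x' i`-gradient very positive, forcing `x' i = 0`
        have hx'_eq : x' i = 0 := by
          by_contra hne
          have hlt : 0 < x' i := lt_of_le_of_ne hx'0 (Ne.symm hne)
          rw [h1] at hx'_int hx'_one
          rcases hx'1.eq_or_lt with h | h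
          · linarith [hx'_one h]
          · linarith [(abs_le.mp (hx'_int ⟨hlt, h⟩)).2]
        have := hy_one h1
        rw [abs_le]
        constructor <;> nlinarith
      · have h := hy_int ⟨h0, h1⟩
        rw [abs_mul, abs_of_pos (by linarith : 0 < 10 * Z)] at h
        nlinarith [abs_nonneg (x' i - (1 - 2 * η) * x i - η)]
  obtain ⟨hlow, hupp⟩ := abs_le.mp hcopy
  refine ⟨hcopy, ⟨by nlinarith, by nlinarith⟩, ?_⟩
  rw [abs_le]
  constructor <;> nlinarith
end

section
/- Let ε ∈ (0, 1/13] and δ = ε²/Z. If (x, x', y) ∈ [0,1]^{3n} is a δ-approximate KKT point of min_{(x,x') ∈ [0,1]^{2n}} max_{y ∈ [0,1]^n} M(x, x', y), then for every i ∈ [n]: |∂Q(x)/∂x_i − ∂M(x, x', y)/∂x_i| ≤ 12ε². -/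
open Finset

/-- A diagonal coefficient is bounded by the sum of the absolute values of all coefficients. -/
theorem abs_diag_le_of_sum_abs_le {n : ℕ} {c : ℝ} {ql : Fin n → ℝ} {qc : Fin n → Fin n → ℝ} {Z : ℝ}
    (hcoef : |c| + (∑ i, |ql i|) + (∑ i, ∑ j ∈ univ \ {i}, |qc i j|) + (∑ i, |qc i i|) ≤ Z)
    (i : Fin n) : |qc i i| ≤ Z := by
  have hdiag : |qc i i| ≤ ∑ i, |qc i i| :=
    single_le_sum (f := fun i => |qc i i|) (fun _ _ => abs_nonneg _) (mem_univ i)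
  have hlin : 0 ≤ ∑ i, |ql i| := sum_nonneg fun _ _ => abs_nonneg _
  have hoff : 0 ≤ ∑ i, ∑ j ∈ univ \ {i}, |qc i j| :=
    sum_nonneg fun _ _ => sum_nonneg fun _ _ => abs_nonneg _
  linarith [abs_nonneg c]

/-- At a `δ`-approximate KKT point in the pair `(x', y)`, with `η = 2δ` and `T = 10Z`, the
multiplier variable `y` lies in the interior of `[0, 1]`. -/
theorem multiplier_mem_Ioo {Z δ a x x' y : ℝ} (hZ : 1 ≤ Z) (hδ : 0 < δ) (hδ' : δ ≤ 1 / 169)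
    (ha : |a| ≤ Z) (hx : x ∈ Set.Icc (0 : ℝ) 1) (hx' : x' ∈ Set.Icc (0 : ℝ) 1)
    (hy : y ∈ Set.Icc (0 : ℝ) 1)
    (hkktx' : (x' ∈ Set.Ioo (0 : ℝ) 1 → |a * x + 10 * Z * (y - 1 / 2)| ≤ δ) ∧
      (x' = 0 → -δ ≤ a * x + 10 * Z * (y - 1 / 2)) ∧
      (x' = 1 → a * x + 10 * Z * (y - 1 / 2) ≤ δ))
    (hkkty : (y = 0 → 10 * Z * (x' - (1 - 2 * (2 * δ)) * x - 2 * δ) ≤ δ) ∧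
      (y = 1 → -δ ≤ 10 * Z * (x' - (1 - 2 * (2 * δ)) * x - 2 * δ))) :
    y ∈ Set.Ioo (0 : ℝ) 1 := by
  obtain ⟨hx0, hx1⟩ := hx
  have hax : |a * x| ≤ Z := by
    rw [abs_mul, abs_of_nonneg hx0]
    nlinarith [abs_nonneg a]
  obtain ⟨hax1, hax2⟩ := abs_le.1 hax
  have hZδ : δ ≤ Z * δ := by nlinarith
  refine ⟨lt_of_le_of_ne hy.1 fun h => ?_, lt_of_le_of_ne hy.2 fun h => ?_⟩
  · subst h
    have hx'1 : x' = 1 := by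
      by_contra hne
      rcases eq_or_lt_of_le hx'.1 with h0 | h0
      · linarith [hkktx'.2.1 h0.symm]
      · linarith [(abs_le.1 (hkktx'.1 ⟨h0, lt_of_le_of_ne hx'.2 hne⟩)).1]
    have hgy := hkkty.1 rfl
    have hgap : 2 * δ ≤ x' - (1 - 2 * (2 * δ)) * x - 2 * δ := by
      rw [hx'1]
      nlinarith
    nlinarith
  · subst h
    have hx'0 : x' = 0 := by
      by_contra hne
      rcases eq_or_lt_of_le hx'.2 with h1 | h1
      · linarith [hkktx'.2.2 h1]
      · linarith [(abs_le.1 (hkktx'.1 ⟨lt_of_le_of_ne hx'.1 (Ne.symm hne), h1⟩)).2]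
    have hgy := hkkty.2 rfl
    have hgap : x' - (1 - 2 * (2 * δ)) * x - 2 * δ ≤ -(2 * δ) := by
      rw [hx'0]
      nlinarith
    nlinarith

/-- The one-coordinate estimate: replacing `x²` by `x x'` together with the penalty term changes
the derivative in `x` by at most `12 Z δ` at a `δ`-approximate KKT point. -/
theorem abs_derivative_gap_le {Z δ a x x' y : ℝ} (hZ : 1 ≤ Z) (hδ : 0 < δ) (hδ' : δ ≤ 1 / 169)
    (ha : |a| ≤ Z) (hx : x ∈ Set.Icc (0 : ℝ) 1) (hx' : x' ∈ Set.Icc (0 : ℝ) 1)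
    (hy : y ∈ Set.Icc (0 : ℝ) 1)
    (hkktx' : (x' ∈ Set.Ioo (0 : ℝ) 1 → |a * x + 10 * Z * (y - 1 / 2)| ≤ δ) ∧
      (x' = 0 → -δ ≤ a * x + 10 * Z * (y - 1 / 2)) ∧
      (x' = 1 → a * x + 10 * Z * (y - 1 / 2) ≤ δ))
    (hkkty : (y ∈ Set.Ioo (0 : ℝ) 1 → |10 * Z * (x' - (1 - 2 * (2 * δ)) * x - 2 * δ)| ≤ δ) ∧
      (y = 0 → 10 * Z * (x' - (1 - 2 * (2 * δ)) * x - 2 * δ) ≤ δ) ∧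
      (y = 1 → -δ ≤ 10 * Z * (x' - (1 - 2 * (2 * δ)) * x - 2 * δ))) :
    |2 * a * x - a * x' - 10 * Z * (1 - 2 * (2 * δ)) * (1 / 2 - y)| ≤ 12 * (Z * δ) := by
  have hgy := hkkty.1 (multiplier_mem_Ioo hZ hδ hδ' ha hx hx' hy hkktx' hkkty.2)
  obtain ⟨hx0, hx1⟩ := hx
  have hgap : |x' - (1 - 2 * (2 * δ)) * x - 2 * δ| ≤ δ / 10 := by
    rw [abs_mul, abs_of_pos (by linarith : 0 < 10 * Z)] at hgy
    nlinarith [abs_nonneg (x' - (1 - 2 * (2 * δ)) * x - 2 * δ)]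
  obtain ⟨hgap1, hgap2⟩ := abs_le.1 hgap
  have hδx0 : 0 ≤ δ * x := by positivity
  have hδx1 : δ * x ≤ δ := by nlinarith
  have hx'_pos : 0 < x' := by nlinarith
  have hx'_lt : x' < 1 := by nlinarith
  have hgx' := hkktx'.1 ⟨hx'_pos, hx'_lt⟩
  have hdist : |x - x'| ≤ 3 * δ := abs_le.2 ⟨by linarith, by linarith⟩
  have hcross : |a * (x - x')| ≤ Z * (3 * δ) := by
    rw [abs_mul]
    exact mul_le_mul ha hdist (abs_nonneg _) (by linarith)
  have hpenalty : |4 * δ * (10 * Z * (y - 1 / 2))| ≤ 4 * δ * (Z + δ) := by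
    rw [abs_mul, abs_of_pos (by linarith : 0 < 4 * δ)]
    refine mul_le_mul_of_nonneg_left ?_ (by linarith)
    have hax : |a * x| ≤ Z := by
      rw [abs_mul, abs_of_nonneg hx0]
      nlinarith [abs_nonneg a]
    rw [abs_le] at hax hgx' ⊢
    constructor <;> linarith
  have hZδ : δ ≤ Z * δ := by nlinarith
  have hδδ : δ * δ ≤ δ := by nlinarith
  rw [abs_le] at hgx' hcross hpenalty ⊢
  constructor <;> nlinarith

/-- at any `δ = ε²/Z`-approximate KKT point `(x, x', y)` of
`min_{(x,x')} max_y M(x, x', y)`, for every `i`: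
`|∂Q(x)/∂xᵢ - ∂M(x,x',y)/∂xᵢ| ≤ 12ε²`. -/
theorem gradients_close
    (n : ℕ) (c : ℝ) (ql : Fin n → ℝ) (qc : Fin n → Fin n → ℝ)
    (Z ε δ T η : ℝ) (hZ : 1 ≤ Z)
    (hcoef : |c| + (∑ i, |ql i|) + (∑ i, ∑ j ∈ univ \ {i}, |qc i j|) + (∑ i, |qc i i|) ≤ Z)
    (hε : ε ∈ Set.Ioc (0 : ℝ) (1 / 13)) (hδ : δ = ε ^ 2 / Z)
    (hT : T = 10 * Z) (hη : η = 2 * ε ^ 2 / Z)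
    -- the candidate point, lying in the box
    (x x' y : Fin n → ℝ)
    (hx : ∀ i, x i ∈ Set.Icc (0 : ℝ) 1) (hx' : ∀ i, x' i ∈ Set.Icc (0 : ℝ) 1)
    (hy : ∀ i, y i ∈ Set.Icc (0 : ℝ) 1)
    -- gradients of M(x, x', y) = Q'(x, x') + T ∑ᵢ (x'ᵢ - (1-2η)xᵢ - η)(yᵢ - 1/2)
    -- at the point (x, x', y), with respect to xᵢ, x'ᵢ and yᵢ respectively
    (gx gx' gy : Fin n → ℝ)
    (hgx : ∀ i, gx i = (ql i + (∑ j ∈ univ \ {i}, (qc i j + qc j i) * x j) + qc i i * x' i)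
      + T * (1 - 2 * η) * (1 / 2 - y i))
    (hgx' : ∀ i, gx' i = qc i i * x i + T * (y i - 1 / 2))
    (hgy : ∀ i, gy i = T * (x' i - (1 - 2 * η) * x i - η))
    -- δ-approximate KKT conditions: (x, x') are min-variables, y are max-variables
    (hkktx : ∀ i, (x i ∈ Set.Ioo (0 : ℝ) 1 → |gx i| ≤ δ) ∧ (x i = 0 → -δ ≤ gx i)
      ∧ (x i = 1 → gx i ≤ δ))
    (hkktx' : ∀ i, (x' i ∈ Set.Ioo (0 : ℝ) 1 → |gx' i| ≤ δ) ∧ (x' i = 0 → -δ ≤ gx' i)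
      ∧ (x' i = 1 → gx' i ≤ δ))
    (hkkty : ∀ i, (y i ∈ Set.Ioo (0 : ℝ) 1 → |gy i| ≤ δ) ∧ (y i = 0 → gy i ≤ δ)
      ∧ (y i = 1 → -δ ≤ gy i))
    -- gradient of Q at x
    (gQ : Fin n → ℝ)
    (hgQ : ∀ i, gQ i = ql i + (∑ j ∈ univ \ {i}, (qc i j + qc j i) * x j) + 2 * qc i i * x i) :
    -- conclusion: ∂Q(x)/∂xᵢ is within 12ε² of ∂M(x,x',y)/∂xᵢ
    ∀ i, |gQ i - gx i| ≤ 12 * ε ^ 2 := by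
  intro i
  have hZpos : 0 < Z := by linarith
  have hδpos : 0 < δ := hδ ▸ div_pos (pow_pos hε.1 2) hZpos
  have hZδ : Z * δ = ε ^ 2 := by
    rw [hδ]
    field_simp
  have hδ_le : δ ≤ 1 / 169 := by nlinarith [hε.1, hε.2]
  have hη' : η = 2 * δ := by rw [hη, hδ, mul_div_assoc]
  have hx'i := hkktx' i
  have hyi := hkkty i
  rw [hgx' i, hT] at hx'i
  rw [hgy i, hT, hη'] at hyi
  rw [← hZδ, hgQ i, hgx i, hT, hη']
  convert abs_derivative_gap_le hZ hδpos hδ_le (abs_diag_le_of_sum_abs_le hcoef i) (hx i) (hx' i)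
    (hy i) hx'i hyi using 2
  ring
end

section
/- Let ε ∈ (0, 1] and δ = ε²/(4Z), and let (p, q) ∈ [0,1]^{2n} be a δ-approximate Nash equilibrium of the two-team game associated with M. Define x ∈ [0,1]^n by x_i = 0 if p_i < ε/(2Z), x_i = 1 if p_i > 1 − ε/(2Z), and x_i = p_i otherwise; define y ∈ [0,1]^n from q in the same way. Then (x, y) is an ε-approximate KKT point of min_{x ∈ [0,1]^n} max_{y ∈ [0,1]^n} M(x, y). -/
open Finset

/-- A row of a symmetric array, off the diagonal, is dominated by its strict upper triangle. -/
theorem sum_abs_row_le_sum_upper {n : ℕ} (γ : Fin n → Fin n → ℝ) (hγ : ∀ i j, γ i j = γ j i)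
    (i : Fin n) :
    ∑ j ∈ univ \ {i}, |γ i j| ≤ ∑ k, ∑ j ∈ univ.filter (fun j => k < j), |γ k j| := by
  have hsplit : (univ \ {i} : Finset (Fin n))
      = univ.filter (fun j => i < j) ∪ univ.filter (fun j => j < i) := by
    ext j
    simp only [mem_sdiff, mem_univ, mem_singleton, true_and, mem_union, mem_filter]
    rw [← ne_eq, ne_iff_lt_or_gt, or_comm]
  have hdisj : Disjoint (univ.filter (fun j => i < j)) (univ.filter (fun j => j < i)) :=
    disjoint_filter.2 fun j _ h => h.not_gt
  have hlower : ∑ j ∈ univ.filter (fun j => j < i), |γ i j|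
      ≤ ∑ k ∈ univ.filter (fun k => k < i), ∑ j ∈ univ.filter (fun j => k < j), |γ k j| := by
    refine sum_le_sum fun k hk => ?_
    rw [hγ i k]
    exact single_le_sum (f := fun j => |γ k j|) (fun j _ => abs_nonneg _)
      (mem_filter.2 ⟨mem_univ i, (mem_filter.1 hk).2⟩)
  have hmem : i ∉ univ.filter (fun k => k < i) := by simp
  calc ∑ j ∈ univ \ {i}, |γ i j|
      ≤ ∑ k ∈ insert i (univ.filter (fun k => k < i)),
          ∑ j ∈ univ.filter (fun j => k < j), |γ k j| := by
        rw [hsplit, sum_union hdisj, sum_insert hmem]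
        gcongr
    _ ≤ _ := sum_le_sum_of_subset_of_nonneg (subset_univ _)
        fun k _ _ => sum_nonneg fun j _ => abs_nonneg _

theorem abs_sum_mul_sub_sum_mul_le {ι : Type*} (s : Finset ι) (c u v : ι → ℝ) {η : ℝ}
    (huv : ∀ j, |u j - v j| ≤ η) :
    |∑ j ∈ s, c j * u j - ∑ j ∈ s, c j * v j| ≤ (∑ j ∈ s, |c j|) * η := by
  rw [← sum_sub_distrib, sum_mul]
  refine (abs_sum_le_sum_abs _ _).trans (sum_le_sum fun j _ => ?_)
  rw [← mul_sub, abs_mul]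
  exact mul_le_mul_of_nonneg_left (huv j) (abs_nonneg _)

theorem rounding_mem_Icc_and_abs_sub_le {η p x : ℝ} (hη : 0 < η) (hp : p ∈ Set.Icc (0 : ℝ) 1)
    (hx : x = if p < η then 0 else if 1 - η < p then 1 else p) :
    x ∈ Set.Icc (0 : ℝ) 1 ∧ |x - p| ≤ η := by
  obtain ⟨h0, h1⟩ := hp
  rw [abs_le]
  split_ifs at hx <;> subst hx <;> refine ⟨⟨?_, ?_⟩, ?_, ?_⟩ <;> linarith

/-- If moving `p` within `[0, 1]` decreases the linear cost with slope `D` by at most `η * (ε / 2)`,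
then the rounding of `p` satisfies the `ε`-approximate KKT conditions for every slope `g` within
`ε / 2` of `D`. -/
theorem rounding_approx_kkt {η ε p x D g : ℝ} (hη : 0 < η) (hη' : η ≤ 1 / 2) (hε : 0 < ε)
    (hx : x = if p < η then 0 else if 1 - η < p then 1 else p)
    (hD : ∀ t ∈ Set.Icc (0 : ℝ) 1, (p - t) * D ≤ η * (ε / 2)) (hg : |g - D| ≤ ε / 2) :
    (x ∈ Set.Ioo (0 : ℝ) 1 → |g| ≤ ε) ∧ (x = 0 → -ε ≤ g) ∧ (x = 1 → g ≤ ε) := by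
  obtain ⟨hg₁, hg₂⟩ := abs_le.1 hg
  have hupper : η ≤ p → g ≤ ε := fun h => by
    have := hD 0 (by simp)
    by_contra! hlt
    nlinarith
  have hlower : p ≤ 1 - η → -ε ≤ g := fun h => by
    have := hD 1 (by simp)
    by_contra! hlt
    nlinarith
  split_ifs at hx with h₁ h₂ <;> subst hx
  · exact ⟨fun h => absurd h.1 (lt_irrefl _), fun _ => hlower (by linarith), fun h => by simp at h⟩
  · exact ⟨fun h => absurd h.2 (lt_irrefl _), fun h => by simp at h, fun _ => hupper (by linarith)⟩
  · push Not at h₁ h₂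
    exact ⟨fun _ => abs_le.2 ⟨hlower h₂, hupper h₁⟩, fun _ => hlower h₂, fun _ => hupper h₁⟩

/-- Claim 2 of the paper: if `(p, q)` is a `δ = ε²/(4Z)`-approximate Nash
equilibrium of the two-team game associated with the multilinear polynomial
`M(x, y) = α + ∑ᵢ βᵢxᵢ + ∑_{i<j} γ_{ij}xᵢxⱼ + ∑ᵢ ζᵢyᵢ + ∑_{i,j} θ_{ij}xᵢyⱼ`, and `(x, y)`
is obtained from `(p, q)` by the rounding rule, then `(x, y)` is an `ε`-approximate KKT
point of `min_{x ∈ [0,1]ⁿ} max_{y ∈ [0,1]ⁿ} M(x, y)`. -/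
theorem stage_two_correctness
    (n : ℕ) (hn : 1 ≤ n)
    (α : ℝ) (β ζ : Fin n → ℝ) (γ θ : Fin n → Fin n → ℝ)
    (hγsymm : ∀ i j, γ i j = γ j i)
    (Z ε δ : ℝ) (hZ : 1 ≤ Z)
    (hcoef : |α| + (∑ i, |β i|) + (∑ i, ∑ j ∈ univ.filter (fun j => i < j), |γ i j|)
      + (∑ i, |ζ i|) + (∑ i, ∑ j, |θ i j|) ≤ Z)
    (hε : ε ∈ Set.Ioc (0 : ℝ) 1) (hδ : δ = ε ^ 2 / (4 * Z))
    -- the mixed-strategy profile: pᵢ (resp. qⱼ) is the probability that player aᵢ (resp. bⱼ)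
    -- plays its first action
    (p q : Fin n → ℝ) (hp : ∀ i, p i ∈ Set.Icc (0 : ℝ) 1) (hq : ∀ i, q i ∈ Set.Icc (0 : ℝ) 1)
    -- utilities: `Ua i t` is the utility of player aᵢ when deviating to probability t,
    -- others fixed at (p, q); similarly `Ub j t` for player bⱼ
    (Ua Ub : Fin n → ℝ → ℝ)
    (hUa : ∀ i t, Ua i t
      = -t * (β i + (∑ j ∈ univ \ {i}, γ i j * p j) + ∑ j, θ i j * q j)
        - (1 / (n : ℝ)) * ∑ j, ζ j * q j)
    (hUb : ∀ j t, Ub j t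
      = t * (ζ j + ∑ i, θ i j * p i) + (1 / (n : ℝ)) * ∑ i, β i * p i)
    -- (p, q) is a δ-approximate Nash equilibrium
    (hNEa : ∀ i, ∀ t ∈ Set.Icc (0 : ℝ) 1, Ua i t ≤ Ua i (p i) + δ)
    (hNEb : ∀ j, ∀ t ∈ Set.Icc (0 : ℝ) 1, Ub j t ≤ Ub j (q j) + δ)
    -- the rounded candidate KKT point
    (x y : Fin n → ℝ)
    (hx : ∀ i, x i = if p i < ε / (2 * Z) then 0
      else if 1 - ε / (2 * Z) < p i then 1 else p i)
    (hy : ∀ i, y i = if q i < ε / (2 * Z) then 0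
      else if 1 - ε / (2 * Z) < q i then 1 else q i)
    -- gradients of M at (x, y): gx i = ∂M/∂xᵢ, gy j = ∂M/∂yⱼ
    (gx gy : Fin n → ℝ)
    (hgx : ∀ i, gx i = β i + (∑ j ∈ univ \ {i}, γ i j * x j) + ∑ j, θ i j * y j)
    (hgy : ∀ j, gy j = ζ j + ∑ i, θ i j * x i) :
    -- conclusion: (x, y) is an ε-approximate KKT point of min_x max_y M(x, y)
    (∀ i, x i ∈ Set.Icc (0 : ℝ) 1 ∧ y i ∈ Set.Icc (0 : ℝ) 1) ∧
    (∀ i, (x i ∈ Set.Ioo (0 : ℝ) 1 → |gx i| ≤ ε) ∧ (x i = 0 → -ε ≤ gx i)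
      ∧ (x i = 1 → gx i ≤ ε)) ∧
    (∀ i, (y i ∈ Set.Ioo (0 : ℝ) 1 → |gy i| ≤ ε) ∧ (y i = 0 → gy i ≤ ε)
      ∧ (y i = 1 → -ε ≤ gy i)) := by
  obtain ⟨hε₀, hε₁⟩ := hε
  have hZ₀ : 0 < Z := by linarith
  have hη : 0 < ε / (2 * Z) := by positivity
  have hη' : ε / (2 * Z) ≤ 1 / 2 := by
    rw [div_le_div_iff₀ (by positivity) (by norm_num)]
    linarith
  have hZη : Z * (ε / (2 * Z)) = ε / 2 := by field_simp
  have hδη : δ = ε / (2 * Z) * (ε / 2) := by rw [hδ]; field_simp; norm_num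
  have hxp := fun i => rounding_mem_Icc_and_abs_sub_le hη (hp i) (hx i)
  have hyq := fun i => rounding_mem_Icc_and_abs_sub_le hη (hq i) (hy i)
  have hα := abs_nonneg α
  have hβ : 0 ≤ ∑ i, |β i| := sum_nonneg fun _ _ => abs_nonneg _
  have hζ : 0 ≤ ∑ i, |ζ i| := sum_nonneg fun _ _ => abs_nonneg _
  have hγ₀ : 0 ≤ ∑ i, ∑ j ∈ univ.filter (fun j => i < j), |γ i j| :=
    sum_nonneg fun _ _ => sum_nonneg fun _ _ => abs_nonneg _
  refine ⟨fun i => ⟨(hxp i).1, (hyq i).1⟩, fun i => ?_, fun j => ?_⟩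
  · refine rounding_approx_kkt
      (D := β i + (∑ j ∈ univ \ {i}, γ i j * p j) + ∑ j, θ i j * q j) hη hη' hε₀ (hx i) ?_ ?_
    · intro t ht
      have h := hNEa i t ht
      rw [hUa, hUa] at h
      linarith
    · have hrow : ∑ j, |θ i j| ≤ ∑ i, ∑ j, |θ i j| :=
        single_le_sum (f := fun i => ∑ j, |θ i j|)
          (fun _ _ => sum_nonneg fun _ _ => abs_nonneg _) (mem_univ i)
      have hcoef_row : (∑ j ∈ univ \ {i}, |γ i j|) + ∑ j, |θ i j| ≤ Z := by
        linarith [sum_abs_row_le_sum_upper γ hγsymm i]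
      have hbound := mul_le_mul_of_nonneg_right hcoef_row hη.le
      have h₁ := abs_le.1 (abs_sum_mul_sub_sum_mul_le (univ \ {i}) (γ i) x p fun j => (hxp j).2)
      have h₂ := abs_le.1 (abs_sum_mul_sub_sum_mul_le univ (θ i) y q fun j => (hyq j).2)
      rw [hZη, add_mul] at hbound
      rw [hgx, abs_le]
      constructor <;> linarith [h₁.1, h₁.2, h₂.1, h₂.2]
  · have hkkt := rounding_approx_kkt (D := -(ζ j + ∑ i, θ i j * p i)) (g := -gy j)
      hη hη' hε₀ (hy j) ?_ ?_
    · rw [abs_neg] at hkkt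
      exact ⟨hkkt.1, fun h => neg_le_neg_iff.1 (hkkt.2.1 h), fun h => neg_le.1 (hkkt.2.2 h)⟩
    · intro t ht
      have h := hNEb j t ht
      rw [hUb, hUb] at h
      linarith
    · have hcol : ∑ i, |θ i j| ≤ ∑ i, ∑ j, |θ i j| :=
        sum_le_sum fun i _ => single_le_sum (f := fun j => |θ i j|)
          (fun _ _ => abs_nonneg _) (mem_univ j)
      have hcoef_col : ∑ i, |θ i j| ≤ Z := by linarith
      have hbound := mul_le_mul_of_nonneg_right hcoef_col hη.le
      have h := abs_le.1 (abs_sum_mul_sub_sum_mul_le univ (fun i => θ i j) x p fun i => (hxp i).2)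
      rw [hZη] at hbound
      rw [hgy, abs_le]
      constructor <;> linarith [h.1, h.2]
end

section
/- In the polymatrix game with 2×2 payoff matrices A^{a_i,a_j} = A^{a_j,a_i} = [[−γ_{ij}, 0],[0, 0]] for i ≠ j, A^{b_j,a_i} = −(A^{a_i,b_j})^⊤ = [[θ_{ij} + ζ_j/n + β_i/n, ζ_j/n],[β_i/n, 0]] for all i, j ∈ [n], and all other matrices zero, where each player a_i mixes as (p_i, 1−p_i) and each player b_j mixes as (q_j, 1−q_j), the total polymatrix utilities satisfy: U_{a_i}(p, q) = \sum_{j ≠ i} (p_i, 1−p_i) A^{a_i,a_j} (p_j, 1−p_j)^⊤ + \sum_j (p_i, 1−p_i) A^{a_i,b_j} (q_j, 1−q_j)^⊤ = −p_i·(β_i + \sum_{j ≠ i} γ_{ij} p_j + \sum_j θ_{ij} q_j) − (1/n)\sum_j ζ_j q_j, and U_{b_j}(p, q) = \sum_i (q_j, 1−q_j) A^{b_j,a_i} (p_i, 1−p_i)^⊤ = q_j·(ζ_j + \sum_i θ_{ij} p_i) + (1/n)\sum_i β_i p_i. -/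
open Finset Matrix

/-- in the polymatrix game with the given 2×2 payoff matrices, where each
player aᵢ mixes as (pᵢ, 1-pᵢ) and each player bⱼ mixes as (qⱼ, 1-qⱼ), the total
polymatrix utilities have the stated closed forms. -/
theorem polymatrix_utilities_closed_form
    (n : ℕ) (hn : 1 ≤ n)
    (β ζ : Fin n → ℝ) (γ θ : Fin n → Fin n → ℝ)
    (hγsymm : ∀ i j, γ i j = γ j i)
    (p q : Fin n → ℝ)
    (Aaa Aab Aba : Fin n → Fin n → Matrix (Fin 2) (Fin 2) ℝ)
    (hAaa : ∀ i j, Aaa i j = !![-γ i j, 0; 0, 0])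
    (hAaa_symm : ∀ i j, Aaa i j = Aaa j i)
    (hAba : ∀ j i, Aba j i
      = !![θ i j + ζ j / (n : ℝ) + β i / (n : ℝ), ζ j / (n : ℝ); β i / (n : ℝ), 0])
    (hAab : ∀ i j, Aab i j = -(Aba j i)ᵀ) :
    (∀ i, (∑ j ∈ univ \ {i}, ![p i, 1 - p i] ⬝ᵥ ((Aaa i j).mulVec ![p j, 1 - p j]))
        + (∑ j, ![p i, 1 - p i] ⬝ᵥ ((Aab i j).mulVec ![q j, 1 - q j]))
      = -(p i) * (β i + (∑ j ∈ univ \ {i}, γ i j * p j) + ∑ j, θ i j * q j)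
        - (1 / (n : ℝ)) * ∑ j, ζ j * q j) ∧
    (∀ j, (∑ i, ![q j, 1 - q j] ⬝ᵥ ((Aba j i).mulVec ![p i, 1 - p i]))
      = q j * (ζ j + ∑ i, θ i j * p i) + (1 / (n : ℝ)) * ∑ i, β i * p i) := by
  have hn0 : (n : ℝ) ≠ 0 := by positivity
  have sum_div_card (c : ℝ) : ∑ _j : Fin n, c / (n : ℝ) = c := by
    simp only [sum_const, card_univ, Fintype.card_fin, nsmul_eq_mul]
    field_simp
  have haa (i j : Fin n) : ![p i, 1 - p i] ⬝ᵥ ((Aaa i j).mulVec ![p j, 1 - p j])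
      = -(p i) * (γ i j * p j) := by
    simp [hAaa, dotProduct, mulVec, Fin.sum_univ_two]
  have hba (j i : Fin n) : ![q j, 1 - q j] ⬝ᵥ ((Aba j i).mulVec ![p i, 1 - p i])
      = q j * (θ i j * p i) + q j * ζ j / n + 1 / n * (β i * p i) := by
    simp [hAba, dotProduct, mulVec, Fin.sum_univ_two]
    ring
  have hab (i j : Fin n) : ![p i, 1 - p i] ⬝ᵥ ((Aab i j).mulVec ![q j, 1 - q j])
      = -(p i) * (θ i j * q j) + -(p i) * β i / n + -(1 / n) * (ζ j * q j) := by
    simp [hAab, hAba, dotProduct, mulVec, Fin.sum_univ_two]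
    ring
  constructor
  · intro i
    simp only [haa, hab, sum_add_distrib, sum_div_card, ← mul_sum]
    ring
  · intro j
    simp only [hba, sum_add_distrib, sum_div_card, ← mul_sum]
    ring
end

section
/- Define the common utility U(x, y) = −\sum_{i<i', i,i' ∈ X} x_i^⊤ A^{i,i'} x_{i'} − \sum_{i ∈ X, j ∈ Y} x_i^⊤ A^{i,j} y_j. Then for every ε ≥ 0, a mixed strategy profile (x, y) is an ε-approximate Nash equilibrium of the two-team polymatrix zero-sum game with independent adversaries if and only if it is an ε-approximate Nash equilibrium of the game with the same strategy sets in which every player i ∈ X has utility function −U and every player j ∈ Y has utility function U. -/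
open Finset Matrix

/-- A sum over unordered pairs splits into the pairs containing `k` and the pairs avoiding `k`. -/
lemma sum_lt_eq_sum_pairs_containing_add_sum_pairs_avoiding {ι M : Type*} [Fintype ι]
    [LinearOrder ι] [AddCommMonoid M] (f : ι → ι → M) (hf : ∀ i i', i ≠ i' → f i i' = f i' i)
    (k : ι) :
    ∑ i, ∑ i' ∈ univ.filter (fun i' => i < i'), f i i' =
      (∑ i' ∈ univ \ {k}, f k i') +
        ∑ i ∈ univ \ {k}, ∑ i' ∈ univ \ {k}, if i < i' then f i i' else 0 := by
  simp only [Finset.sum_filter]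
  have split (g : ι → M) : ∑ i, g i = g k + ∑ i ∈ univ \ {k}, g i := by
    rw [← Finset.sum_sdiff (Finset.subset_univ {k}), Finset.sum_singleton, add_comm]
  rw [split]
  simp only [split (fun i' => if _ < i' then _ else _), lt_irrefl, if_false, zero_add]
  rw [Finset.sum_add_distrib, ← add_assoc, ← Finset.sum_add_distrib]
  congr 1
  refine Finset.sum_congr rfl fun i hi => ?_
  have hik : i ≠ k := by simpa using hi
  rcases lt_or_gt_of_ne hik with h | h
  · simp [h, h.not_gt, hf i k hik]
  · simp [h, h.not_gt]

/-- The bilinear form of a transposed matrix swaps its two arguments. -/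
lemma dotProduct_transpose_mulVec_comm {m n R : Type*} [Fintype m] [Fintype n] [CommSemiring R]
    (A : Matrix m n R) (v : n → R) (w : m → R) :
    v ⬝ᵥ Aᵀ.mulVec w = w ⬝ᵥ A.mulVec v := by
  rw [Matrix.mulVec_transpose, dotProduct_comm, Matrix.dotProduct_mulVec]

/-- a mixed strategy profile `(x, y)` is an `ε`-approximate Nash equilibrium
of the two-team polymatrix zero-sum game with independent adversaries if and only if it is
an `ε`-approximate Nash equilibrium of the game in which every player of team `X` has
utility `-U` and every player of team `Y` has utility `U`, where
`U(x, y) = -∑_{i<i'} xᵢᵀ A^{i,i'} x_{i'} - ∑_{i,j} xᵢᵀ A^{i,j} yⱼ`. -/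
theorem common_utility_equivalence
    (NX NY m : ℕ) (hm : 1 ≤ m)
    (AXX : Fin NX → Fin NX → Matrix (Fin m) (Fin m) ℝ)
    (AXY : Fin NX → Fin NY → Matrix (Fin m) (Fin m) ℝ)
    (AYX : Fin NY → Fin NX → Matrix (Fin m) (Fin m) ℝ)
    (hsymm : ∀ i i', i ≠ i' → AXX i i' = (AXX i' i)ᵀ)
    (hzs : ∀ i j, AXY i j = -(AYX j i)ᵀ)
    -- utilities of the polymatrix game
    (UX : Fin NX → (Fin NX → Fin m → ℝ) → (Fin NY → Fin m → ℝ) → ℝ)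
    (UY : Fin NY → (Fin NX → Fin m → ℝ) → (Fin NY → Fin m → ℝ) → ℝ)
    (hUX : ∀ i x y, UX i x y = (∑ i' ∈ univ \ {i}, x i ⬝ᵥ (AXX i i').mulVec (x i'))
      + ∑ j, x i ⬝ᵥ (AXY i j).mulVec (y j))
    (hUY : ∀ j x y, UY j x y = ∑ i, y j ⬝ᵥ (AYX j i).mulVec (x i))
    -- the common utility function
    (U : (Fin NX → Fin m → ℝ) → (Fin NY → Fin m → ℝ) → ℝ)
    (hU : ∀ x y, U x y
      = -(∑ i, ∑ i' ∈ univ.filter (fun i' => i < i'), x i ⬝ᵥ (AXX i i').mulVec (x i'))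
        - ∑ i, ∑ j, x i ⬝ᵥ (AXY i j).mulVec (y j))
    (ε : ℝ) (hε : 0 ≤ ε)
    (x : Fin NX → Fin m → ℝ) (y : Fin NY → Fin m → ℝ)
    (hx : ∀ i, x i ∈ stdSimplex ℝ (Fin m)) (hy : ∀ j, y j ∈ stdSimplex ℝ (Fin m)) :
    -- (x, y) is an ε-NE of the polymatrix game ↔ it is an ε-NE of the common-utility game
    ((∀ i, ∀ xi' ∈ stdSimplex ℝ (Fin m),
        UX i (Function.update x i xi') y ≤ UX i x y + ε) ∧
     (∀ j, ∀ yj' ∈ stdSimplex ℝ (Fin m),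
        UY j x (Function.update y j yj') ≤ UY j x y + ε))
    ↔
    ((∀ i, ∀ xi' ∈ stdSimplex ℝ (Fin m),
        -U (Function.update x i xi') y ≤ -U x y + ε) ∧
     (∀ j, ∀ yj' ∈ stdSimplex ℝ (Fin m),
        U x (Function.update y j yj') ≤ U x y + ε)) := by
  have sum_erase_update {n : ℕ} {M : Type} [AddCommMonoid M] (z : Fin n → Fin m → ℝ) (k : Fin n)
      (v : Fin m → ℝ) (g : Fin n → (Fin m → ℝ) → M) :
      ∑ i ∈ univ \ {k}, g i (Function.update z k v i) = ∑ i ∈ univ \ {k}, g i (z i) :=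
    Finset.sum_congr rfl fun i hi => by
      rw [Function.update_of_ne (by simpa using hi)]
  have split {n : ℕ} (k : Fin n) (g : Fin n → ℝ) : ∑ i, g i = g k + ∑ i ∈ univ \ {k}, g i := by
    rw [← Finset.sum_sdiff (Finset.subset_univ {k}), Finset.sum_singleton, add_comm]
  have neg_U_eq (k : Fin NX) (z : Fin NX → Fin m → ℝ) : -U z y = UX k z y +
      ((∑ i ∈ univ \ {k}, ∑ i' ∈ univ \ {k},
        if i < i' then z i ⬝ᵥ (AXX i i').mulVec (z i') else 0) +
        ∑ i ∈ univ \ {k}, ∑ j, z i ⬝ᵥ (AXY i j).mulVec (y j)) := by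
    rw [hU, hUX, sum_lt_eq_sum_pairs_containing_add_sum_pairs_avoiding _ _ k, split k]
    · ring
    · intro i i' hne
      rw [hsymm i i' hne, dotProduct_transpose_mulVec_comm]
  have U_eq (k : Fin NY) (w : Fin NY → Fin m → ℝ) : U x w = UY k x w +
      (-(∑ i, ∑ i' ∈ univ.filter (fun i' => i < i'), x i ⬝ᵥ (AXX i i').mulVec (x i')) +
        ∑ j ∈ univ \ {k}, ∑ i, w j ⬝ᵥ (AYX j i).mulVec (x i)) := by
    have cross : ∑ i, ∑ j, x i ⬝ᵥ (AXY i j).mulVec (w j) =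
        -∑ j, ∑ i, w j ⬝ᵥ (AYX j i).mulVec (x i) := by
      rw [Finset.sum_comm]
      simp only [hzs, Matrix.neg_mulVec, dotProduct_neg, dotProduct_transpose_mulVec_comm,
        Finset.sum_neg_distrib]
    rw [hU, hUY, cross, split k]
    ring
  have team_X (k : Fin NX) (v : Fin m → ℝ) :
      UX k (Function.update x k v) y - UX k x y = -U (Function.update x k v) y - -U x y := by
    rw [neg_U_eq k, neg_U_eq k x,
      sum_erase_update x k v fun i u => ∑ j, u ⬝ᵥ (AXY i j).mulVec (y j),
      sum_erase_update x k v fun i u => ∑ i' ∈ univ \ {k}, if i < i' then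
        u ⬝ᵥ (AXX i i').mulVec (Function.update x k v i') else 0]
    have inner (i : Fin NX) := sum_erase_update x k v fun i' u =>
      if i < i' then x i ⬝ᵥ (AXX i i').mulVec u else 0
    simp only [inner]
    ring
  have team_Y (k : Fin NY) (v : Fin m → ℝ) :
      UY k x (Function.update y k v) - UY k x y = U x (Function.update y k v) - U x y := by
    rw [U_eq k, U_eq k y, sum_erase_update y k v fun j u => ∑ i, u ⬝ᵥ (AYX j i).mulVec (x i)]
    ring
  simp only [← sub_le_iff_le_add', team_X, team_Y]
end

section
/- Suppose that for every i ∈ X we are given x*_i ∈ Δ_m, λ*_i ∈ \mathbb{R} and ν*_i ∈ \mathbb{R}^m with ν*_i ≥ 0 and (ν*_{ik} > 0 ⇒ x*_{ik} = 0), and for every j ∈ Y we are given μ*_j ∈ \mathbb{R}^m with μ*_j ≥ 0 and \sum_k μ*_{jk} = 1, and γ*_j ∈ \mathbb{R} with γ*_j ≥ (\sum_{i ∈ X} A^{j,i} x*_i)_k for all k ∈ [m]. Assume furthermore: (1) for every i ∈ X, −\sum_{i' ≠ i} A^{i,i'} x*_{i'} − \sum_{j ∈ Y} A^{i,j} μ*_j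 + λ*_i·1_m − ν*_i = 0, where 1_m is the all-ones vector; and (2) for every j ∈ Y and k ∈ [m], μ*_{jk} > 0 implies γ*_j = (\sum_{i ∈ X} A^{j,i} x*_i)_k. Then the profile (x*, μ*) is an exact Nash equilibrium of the two-team polymatrix zero-sum game with independent adversaries. -/
open Finset Matrix

/-- A mixed strategy supported on the coordinates where a payoff vector attains an upper bound
is a best response to that payoff vector. -/
theorem dotProduct_le_dotProduct_of_mem_stdSimplex {ι : Type*} [Fintype ι] {x y v : ι → ℝ} {c : ℝ}
    (hx : x ∈ stdSimplex ℝ ι) (hy : y ∈ stdSimplex ℝ ι) (hv : ∀ k, v k ≤ c)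
    (hsupp : ∀ k, 0 < x k → v k = c) : y ⬝ᵥ v ≤ x ⬝ᵥ v := by
  have hyc : y ⬝ᵥ v ≤ c := by
    calc y ⬝ᵥ v ≤ ∑ k, y k * c :=
          Finset.sum_le_sum fun k _ => mul_le_mul_of_nonneg_left (hv k) (hy.1 k)
      _ = c := by rw [← Finset.sum_mul, hy.2, one_mul]
  have hxc : x ⬝ᵥ v = c := by
    calc x ⬝ᵥ v = ∑ k, x k * c := by
          refine Finset.sum_congr rfl fun k _ => ?_
          rcases (hx.1 k).eq_or_lt with h | h
          · rw [← h, zero_mul, zero_mul]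
          · rw [hsupp k h]
      _ = c := by rw [← Finset.sum_mul, hx.2, one_mul]
  exact hyc.trans_eq hxc.symm

/-- given multipliers satisfying the KKT conditions of the minimization
reformulation, the profile `(x*, μ*)` is an exact Nash equilibrium of the two-team
polymatrix zero-sum game with independent adversaries. -/
theorem kkt_point_gives_nash_equilibrium
    (NX NY m : ℕ) (hm : 1 ≤ m)
    (AXX : Fin NX → Fin NX → Matrix (Fin m) (Fin m) ℝ)
    (AXY : Fin NX → Fin NY → Matrix (Fin m) (Fin m) ℝ)
    (AYX : Fin NY → Fin NX → Matrix (Fin m) (Fin m) ℝ)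
    (hsymm : ∀ i i', i ≠ i' → AXX i i' = (AXX i' i)ᵀ)
    (hzs : ∀ i j, AXY i j = -(AYX j i)ᵀ)
    -- utilities of the polymatrix game
    (UX : Fin NX → (Fin NX → Fin m → ℝ) → (Fin NY → Fin m → ℝ) → ℝ)
    (UY : Fin NY → (Fin NX → Fin m → ℝ) → (Fin NY → Fin m → ℝ) → ℝ)
    (hUX : ∀ i x y, UX i x y = (∑ i' ∈ univ \ {i}, x i ⬝ᵥ (AXX i i').mulVec (x i'))
      + ∑ j, x i ⬝ᵥ (AXY i j).mulVec (y j))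
    (hUY : ∀ j x y, UY j x y = ∑ i, y j ⬝ᵥ (AYX j i).mulVec (x i))
    -- the KKT point and multipliers
    (xs : Fin NX → Fin m → ℝ) (μ : Fin NY → Fin m → ℝ)
    (lam : Fin NX → ℝ) (ν : Fin NX → Fin m → ℝ) (γ : Fin NY → ℝ)
    (hxs : ∀ i, xs i ∈ stdSimplex ℝ (Fin m))
    (hν : ∀ i k, 0 ≤ ν i k)
    (hcs1 : ∀ i k, 0 < ν i k → xs i k = 0)
    (hμ : ∀ j, μ j ∈ stdSimplex ℝ (Fin m))
    (hγ : ∀ (j : Fin NY) (k : Fin m), (∑ i, (AYX j i).mulVec (xs i)) k ≤ γ j)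
    -- stationarity: for every i ∈ X, -∑_{i'≠i} A^{i,i'} x*_{i'} - ∑_j A^{i,j} μ*_j
    -- + λ*_i·1_m - ν*_i = 0
    (hstat : ∀ (i : Fin NX) (k : Fin m),
      -((∑ i' ∈ univ \ {i}, (AXX i i').mulVec (xs i')) k)
      - ((∑ j, (AXY i j).mulVec (μ j)) k) + lam i - ν i k = 0)
    -- complementary slackness for the adversaries
    (hcs2 : ∀ (j : Fin NY) (k : Fin m), 0 < μ j k → γ j = (∑ i, (AYX j i).mulVec (xs i)) k) :
    -- conclusion: (x*, μ*) is an exact Nash equilibrium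
    (∀ i, ∀ xi' ∈ stdSimplex ℝ (Fin m), UX i (Function.update xs i xi') μ ≤ UX i xs μ) ∧
    (∀ j, ∀ yj' ∈ stdSimplex ℝ (Fin m), UY j xs (Function.update μ j yj') ≤ UY j xs μ) := by
  refine ⟨fun i xi' hxi' => ?_, fun j yj' hyj' => ?_⟩
  · have hothers : ∑ i' ∈ univ \ {i}, xi' ⬝ᵥ (AXX i i').mulVec (Function.update xs i xi' i')
        = ∑ i' ∈ univ \ {i}, xi' ⬝ᵥ (AXX i i').mulVec (xs i') := by
      refine Finset.sum_congr rfl fun i' hi' => ?_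
      rw [Function.update_of_ne (by simpa using hi')]
    rw [hUX, hUX, Function.update_self, hothers]
    simp only [← dotProduct_sum, ← dotProduct_add]
    refine dotProduct_le_dotProduct_of_mem_stdSimplex (c := lam i) (hxs i) hxi'
      (fun k => ?_) (fun k hk => ?_)
    · rw [Pi.add_apply]
      linarith [hstat i k, hν i k]
    · have hνk : ν i k = 0 :=
        ((hν i k).eq_or_lt.resolve_right fun h => hk.ne' (hcs1 i k h)).symm
      rw [Pi.add_apply]
      linarith [hstat i k]
  · rw [hUY, hUY, Function.update_self]
    simp only [← dotProduct_sum]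
    exact dotProduct_le_dotProduct_of_mem_stdSimplex (hμ j) hyj' (hγ j)
      (fun k hk => (hcs2 j k hk).symm)
end
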